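/- None of the following 4-dimensional real solvable Lie algebras admits a solsoliton inner product: (1) r₄, with basis {A, X₁, X₂, X₃}, abelian nilradical span{X₁, X₂, X₃}, and brackets [A, X₁] = X₁, [A, X₂] = X₁ + X₂, [A, X₃] = X₂ + X₃; (2) r_{4,λ} for every λ ∈ ℝ, with basis {A, X₁, X₂, X₃}, abelian nilradical span{X₁, X₂, X₃}, and brackets [A, X₁] = X₁, [A, X₂] = λX₂, [A, X₃] = X₂ + λX₃; (3) h₄, with basis {A, X₁, X₂, X₃}, nilradical the Heisenberg algebra span{X₁, X₂, X₃} with [X₁, X₂] = X₃, and brackets [A, X₁] = X₁, [A, X₂] = X₁ + X₂, [A, X₃] = 2X₃. -/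

import Mathlib

noncomputable section

open scoped RealInnerProductSpace

/-! ### Lie-algebraic notions for a bracket given as a bundled bilinear map -/

section Alg

variable {E : Type*} [AddCommGroup E] [Module ℝ E]

/-- `μ` is a Lie bracket: alternating and satisfying the (Leibniz form of the) Jacobi identity. -/
def IsLieBracket (μ : E →ₗ[ℝ] E →ₗ[ℝ] E) : Prop :=
  (∀ X, μ X X = 0) ∧ ∀ X Y Z, μ X (μ Y Z) = μ (μ X Y) Z + μ Y (μ X Z)

/-- `D` is a derivation of the algebra `(E, μ)`. -/
def IsDeriv (μ : E →ₗ[ℝ] E →ₗ[ℝ] E) (D : E →ₗ[ℝ] E) : Prop :=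
  ∀ X Y, D (μ X Y) = μ (D X) Y + μ X (D Y)

/-- The subspace spanned by brackets of elements of `p` and `q`. -/
def bracketSpan (μ : E →ₗ[ℝ] E →ₗ[ℝ] E) (p q : Submodule ℝ E) : Submodule ℝ E :=
  Submodule.span ℝ {z | ∃ x ∈ p, ∃ y ∈ q, μ x y = z}

/-- Derived series of `(E, μ)`. -/
def derSeries (μ : E →ₗ[ℝ] E →ₗ[ℝ] E) : ℕ → Submodule ℝ E
  | 0 => ⊤
  | k + 1 => bracketSpan μ (derSeries μ k) (derSeries μ k)

/-- `(E, μ)` is a solvable Lie algebra. -/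
def IsSolvableB (μ : E →ₗ[ℝ] E →ₗ[ℝ] E) : Prop := ∃ k, derSeries μ k = ⊥

/-- Lower central series of the subalgebra `p` of `(E, μ)`. -/
def lcsOn (μ : E →ₗ[ℝ] E →ₗ[ℝ] E) (p : Submodule ℝ E) : ℕ → Submodule ℝ E
  | 0 => p
  | k + 1 => bracketSpan μ p (lcsOn μ p k)

/-- The subalgebra `p` of `(E, μ)` is a nilpotent Lie algebra. -/
def IsNilpotentOn (μ : E →ₗ[ℝ] E →ₗ[ℝ] E) (p : Submodule ℝ E) : Prop := ∃ k, lcsOn μ p k = ⊥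

/-- `p` is an ideal of `(E, μ)`. -/
def IsIdeal (μ : E →ₗ[ℝ] E →ₗ[ℝ] E) (p : Submodule ℝ E) : Prop := ∀ X : E, ∀ Y ∈ p, μ X Y ∈ p

/-- `p` is the nilradical (maximal nilpotent ideal) of `(E, μ)`. -/
def IsNilradical (μ : E →ₗ[ℝ] E →ₗ[ℝ] E) (p : Submodule ℝ E) : Prop :=
  IsIdeal μ p ∧ IsNilpotentOn μ p ∧ ∀ q, IsIdeal μ q → IsNilpotentOn μ q → q ≤ p

/-- The natural action `π(f)μ` of `f ∈ End(E)` on bilinear maps: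
`(π(f)μ)(X,Y) = f(μ(X,Y)) - μ(fX,Y) - μ(X,fY)`. -/
def piAct (f : E →ₗ[ℝ] E) (μ : E →ₗ[ℝ] E →ₗ[ℝ] E) : E →ₗ[ℝ] E →ₗ[ℝ] E :=
  (LinearMap.llcomp ℝ E E E f) ∘ₗ μ - μ ∘ₗ f - (LinearMap.lcomp ℝ E f) ∘ₗ μ

/-- The center of `(E, μ)`. -/
def centerB (μ : E →ₗ[ℝ] E →ₗ[ℝ] E) : Submodule ℝ E where
  carrier := {X | μ X = 0}
  add_mem' := by intro a b ha hb; simp only [Set.mem_setOf_eq, map_add] at *; rw [ha, hb, add_zero]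
  zero_mem' := by simp only [Set.mem_setOf_eq, map_zero]
  smul_mem' := by intro c a ha; simp only [Set.mem_setOf_eq, map_smul] at *; rw [ha, smul_zero]

end Alg

/-! ### Metric notions -/

section MetricDefs

variable {E : Type*} [NormedAddCommGroup E] [InnerProductSpace ℝ E] [FiniteDimensional ℝ E]

/-- The transpose of an operator with respect to the inner product. -/
def transp (f : E →ₗ[ℝ] E) : E →ₗ[ℝ] E := LinearMap.adjoint f

/-- The symmetric part `S(f) = (f + fᵗ)/2` of an operator. -/
def symPart (f : E →ₗ[ℝ] E) : E →ₗ[ℝ] E := (1 / 2 : ℝ) • (f + transp f)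

variable (E) in
/-- A fixed orthonormal basis of `E`. -/
def stdONB : OrthonormalBasis (Fin (Module.finrank ℝ E)) ℝ E := stdOrthonormalBasis ℝ E

/-- The operator `R` appearing in the formula for the Ricci operator of a metric Lie algebra:
`⟨R X, X⟩ = -(1/2) Σ ⟨[X,Xᵢ],Xⱼ⟩² + (1/4) Σ ⟨[Xᵢ,Xⱼ],X⟩²` for any orthonormal basis `{Xᵢ}`. -/
def Rop (μ : E →ₗ[ℝ] E →ₗ[ℝ] E) : E →ₗ[ℝ] E :=
  (-(1 / 2 : ℝ)) • ∑ i, (transp (μ (stdONB E i))) ∘ₗ (μ (stdONB E i))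
    + (1 / 4 : ℝ) • ∑ i, (μ (stdONB E i)) ∘ₗ (transp (μ (stdONB E i)))

/-- The symmetric operator `B` defined by the Killing form: `⟨B X, X⟩ = tr((ad X)²)`. -/
def Bop (μ : E →ₗ[ℝ] E →ₗ[ℝ] E) : E →ₗ[ℝ] E :=
  ∑ i, (((LinearMap.trace ℝ E) ∘ₗ (LinearMap.lcomp ℝ E (μ (stdONB E i))) ∘ₗ μ).smulRight
    (stdONB E i))

/-- The mean curvature vector `H`, characterized by `⟨H, X⟩ = tr (ad X)`. -/
def meanCurv (μ : E →ₗ[ℝ] E →ₗ[ℝ] E) : E :=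
  ∑ i, (LinearMap.trace ℝ E (μ (stdONB E i))) • (stdONB E i : E)

/-- The Ricci operator `Ric = R - (1/2) B - S(ad H)` of a metric Lie algebra. -/
def Ric (μ : E →ₗ[ℝ] E →ₗ[ℝ] E) : E →ₗ[ℝ] E :=
  Rop μ - (1 / 2 : ℝ) • Bop μ - symPart (μ (meanCurv μ))

/-- `(E, μ, ⟨⬝,⬝⟩)` is a solsoliton: `Ric = c I + D` for some `c ∈ ℝ` and derivation `D`. -/
def IsSolsoliton (μ : E →ₗ[ℝ] E →ₗ[ℝ] E) : Prop :=
  ∃ (c : ℝ) (D : E →ₗ[ℝ] E), IsDeriv μ D ∧ Ric μ = c • LinearMap.id + D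

/-- The natural inner product on bilinear maps, `⟨μ,ν⟩ = Σ ⟨μ(Xᵢ,Xⱼ), ν(Xᵢ,Xⱼ)⟩`. -/
def binner (μ ν : E →ₗ[ℝ] E →ₗ[ℝ] E) : ℝ :=
  ∑ i, ∑ j, ⟪μ (stdONB E i) (stdONB E j), ν (stdONB E i) (stdONB E j)⟫

/-- Orthogonal projection onto a subspace, as an endomorphism of `E`. -/
def projL (p : Submodule ℝ E) : E →ₗ[ℝ] E :=
  p.subtype ∘ₗ (Submodule.orthogonalProjection p).toLinearMap

/-- An orthonormal basis of the subspace `p`, as a family of vectors of `E`. -/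
def onbOf (p : Submodule ℝ E) : Fin (Module.finrank ℝ ↥p) → E :=
  fun i => ((stdOrthonormalBasis ℝ ↥p) i : E)

/-- The restriction `ad X |_p` of `ad X` to the subspace `p`, as an endomorphism of `E`
(it kills `pᗮ`). -/
def adOn (μ : E →ₗ[ℝ] E →ₗ[ℝ] E) (p : Submodule ℝ E) (X : E) : E →ₗ[ℝ] E :=
  (μ X) ∘ₗ projL p

/-- The Ricci operator of the restricted metric Lie algebra `(p, μ|ₚ, ⟨⬝,⬝⟩|ₚ)`, for `p` a
bracket-closed subspace, realized as an endomorphism of `E` killing `pᗮ`.  (For `p` nilpotent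
this is the full Ricci operator of `p`.) -/
def RopOn (μ : E →ₗ[ℝ] E →ₗ[ℝ] E) (p : Submodule ℝ E) : E →ₗ[ℝ] E :=
  (-(1 / 2 : ℝ)) • ∑ i, (transp (adOn μ p (onbOf p i))) ∘ₗ (adOn μ p (onbOf p i))
    + (1 / 4 : ℝ) • ∑ i, (adOn μ p (onbOf p i)) ∘ₗ (transp (adOn μ p (onbOf p i)))

/-- The metric nilpotent Lie algebra `(p, μ|ₚ, ⟨⬝,⬝⟩|ₚ)` is a nilsoliton with Ricci operator
`c I + D₁`, where `D₁` is (induced by) a derivation of `p`. -/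
def IsNilsolitonOn (μ : E →ₗ[ℝ] E →ₗ[ℝ] E) (p : Submodule ℝ E) (c : ℝ) (D₁ : E →ₗ[ℝ] E) :
    Prop :=
  (∀ X ∈ p, D₁ X ∈ p) ∧ (∀ X ∈ p, ∀ Y ∈ p, D₁ (μ X Y) = μ (D₁ X) Y + μ X (D₁ Y)) ∧
    ∀ X ∈ p, RopOn μ p X = c • X + D₁ X

end MetricDefs

section FourDimNo

/-- The bracket of `r₄` on the basis `{A, X₁, X₂, X₃}`: `[A,X₁] = X₁`, `[A,X₂] = X₁ + X₂`,
`[A,X₃] = X₂ + X₃`, with abelian nilradical `span{X₁,X₂,X₃}`. -/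
def r4Bracket : (Fin 4 → ℝ) →ₗ[ℝ] (Fin 4 → ℝ) →ₗ[ℝ] (Fin 4 → ℝ) :=
  LinearMap.mk₂ ℝ
    (fun X Y => ![0, (X 0 * Y 1 - Y 0 * X 1) + (X 0 * Y 2 - Y 0 * X 2),
      (X 0 * Y 2 - Y 0 * X 2) + (X 0 * Y 3 - Y 0 * X 3), X 0 * Y 3 - Y 0 * X 3])
    (by intro X X' Y; funext i; fin_cases i <;> simp <;> ring)
    (by intro c X Y; funext i; fin_cases i <;> simp <;> ring)
    (by intro X Y Y'; funext i; fin_cases i <;> simp <;> ring)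
    (by intro c X Y; funext i; fin_cases i <;> simp <;> ring)

/-- The bracket of `r_{4,lam}` on the basis `{A, X₁, X₂, X₃}`: `[A,X₁] = X₁`,
`[A,X₂] = lam X₂`, `[A,X₃] = X₂ + lam X₃`, with abelian nilradical `span{X₁,X₂,X₃}`. -/
def r4lamBracket (lam : ℝ) : (Fin 4 → ℝ) →ₗ[ℝ] (Fin 4 → ℝ) →ₗ[ℝ] (Fin 4 → ℝ) :=
  LinearMap.mk₂ ℝ
    (fun X Y => ![0, X 0 * Y 1 - Y 0 * X 1,
      lam * (X 0 * Y 2 - Y 0 * X 2) + (X 0 * Y 3 - Y 0 * X 3),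
      lam * (X 0 * Y 3 - Y 0 * X 3)])
    (by intro X X' Y; funext i; fin_cases i <;> simp <;> ring)
    (by intro c X Y; funext i; fin_cases i <;> simp <;> ring)
    (by intro X Y Y'; funext i; fin_cases i <;> simp <;> ring)
    (by intro c X Y; funext i; fin_cases i <;> simp <;> ring)

/-- The bracket of `h₄` on the basis `{A, X₁, X₂, X₃}`: `[X₁,X₂] = X₃`, `[A,X₁] = X₁`,
`[A,X₂] = X₁ + X₂`, `[A,X₃] = 2X₃`, with nilradical the Heisenberg algebra
`span{X₁,X₂,X₃}`. -/
def h4Bracket : (Fin 4 → ℝ) →ₗ[ℝ] (Fin 4 → ℝ) →ₗ[ℝ] (Fin 4 → ℝ) :=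
  LinearMap.mk₂ ℝ
    (fun X Y => ![0, (X 0 * Y 1 - Y 0 * X 1) + (X 0 * Y 2 - Y 0 * X 2),
      X 0 * Y 2 - Y 0 * X 2,
      2 * (X 0 * Y 3 - Y 0 * X 3) + (X 1 * Y 2 - Y 1 * X 2)])
    (by intro X X' Y; funext i; fin_cases i <;> simp <;> ring)
    (by intro c X Y; funext i; fin_cases i <;> simp <;> ring)
    (by intro X Y Y'; funext i; fin_cases i <;> simp <;> ring)
    (by intro c X Y; funext i; fin_cases i <;> simp <;> ring)

end FourDimNo

section OrthonormalFrames

variable {E : Type*} [NormedAddCommGroup E] [InnerProductSpace ℝ E] [FiniteDimensional ℝ E]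
variable {ι κ : Type*} [Fintype ι] [Fintype κ]

/-- The trace of a bilinear form with respect to an orthonormal basis does not depend on the
basis. -/
theorem sum_bilin_orthonormalBasis_eq (F : E →ₗ[ℝ] E →ₗ[ℝ] ℝ) (b : OrthonormalBasis ι ℝ E)
    (e : OrthonormalBasis κ ℝ E) : ∑ i, F (b i) (b i) = ∑ i, F (e i) (e i) := by
  classical
  let T : E →ₗ[ℝ] E :=
    ((InnerProductSpace.toDual ℝ E).symm.toLinearEquiv.toLinearMap ∘ₛₗ
      LinearMap.toContinuousLinearMap.toLinearMap) ∘ₗ F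
  have hT : ∀ x y, ⟪T x, y⟫ = F x y := fun x y => by simp [T]
  have h := LinearMap.trace_eq_sum_inner T b
  rw [LinearMap.trace_eq_sum_inner T e] at h
  simpa only [real_inner_comm (T _), hT] using h.symm

theorem sum_inner_bracket_left_eq (μ : E →ₗ[ℝ] E →ₗ[ℝ] E) (b : OrthonormalBasis ι ℝ E)
    (e : OrthonormalBasis κ ℝ E) (x y : E) :
    ∑ i, ⟪μ (b i) x, μ (b i) y⟫ = ∑ i, ⟪μ (e i) x, μ (e i) y⟫ :=
  sum_bilin_orthonormalBasis_eq ((innerₗ E).compl₁₂ (μ.flip x) (μ.flip y)) b e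

theorem sum_inner_transp_eq (μ : E →ₗ[ℝ] E →ₗ[ℝ] E) (b : OrthonormalBasis ι ℝ E)
    (e : OrthonormalBasis κ ℝ E) (x y : E) :
    ∑ i, ⟪transp (μ (b i)) x, transp (μ (b i)) y⟫ =
      ∑ i, ∑ j, ⟪μ (e i) (e j), x⟫ * ⟪μ (e i) (e j), y⟫ := by
  let K (z : E) : E →ₗ[ℝ] E :=
    { toFun := fun v => transp (μ v) z
      map_add' := fun v w => by simp [transp]
      map_smul' := fun c v => by simp [transp] }
  refine (sum_bilin_orthonormalBasis_eq ((innerₗ E).compl₁₂ (K x) (K y)) b e).trans ?_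
  refine Finset.sum_congr rfl fun i _ => ?_
  change ⟪transp (μ (e i)) x, transp (μ (e i)) y⟫ = _
  rw [← e.sum_inner_mul_inner]
  refine Finset.sum_congr rfl fun j _ => ?_
  simp [transp, LinearMap.adjoint_inner_left, LinearMap.adjoint_inner_right, real_inner_comm]

theorem inner_Bop (μ : E →ₗ[ℝ] E →ₗ[ℝ] E) (x y : E) :
    ⟪Bop μ x, y⟫ = LinearMap.trace ℝ E (μ x ∘ₗ μ y) := by
  have hy : μ y = ∑ i, ⟪stdONB E i, y⟫ • μ (stdONB E i) := by
    conv_lhs => rw [← (stdONB E).sum_repr' y]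
    simp
  have hsum : μ x ∘ₗ μ y = ∑ i, ⟪stdONB E i, y⟫ • (μ x ∘ₗ μ (stdONB E i)) := by
    ext z
    simp [hy]
  rw [hsum]
  simp only [Bop, LinearMap.sum_apply, LinearMap.smulRight_apply, sum_inner, inner_smul_left,
    map_sum, map_smul, smul_eq_mul, conj_trivial]
  exact Finset.sum_congr rfl fun i _ => mul_comm _ _

theorem meanCurv_eq (μ : E →ₗ[ℝ] E →ₗ[ℝ] E) (e : OrthonormalBasis κ ℝ E) :
    meanCurv μ = ∑ i, LinearMap.trace ℝ E (μ (e i)) • e i := by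
  refine ext_inner_right ℝ fun y => ?_
  simp only [meanCurv, sum_inner, inner_smul_left]
  exact sum_bilin_orthonormalBasis_eq
    ((LinearMap.trace ℝ E ∘ₗ μ).smulRight ((innerₗ E).flip y)) (stdONB E) e

/-- The matrix entries of the Ricci operator in an orthonormal basis with structure
constants `C`. -/
def ricCoeff (C : κ → κ → κ → ℝ) (i j : κ) : ℝ :=
  -(1 / 2) * ∑ k, ∑ l, C k i l * C k j l + 1 / 4 * ∑ k, ∑ l, C k l i * C k l j
    - 1 / 2 * ∑ k, ∑ l, C i k l * C j l k
    - 1 / 2 * ∑ k, (∑ l, C k l l) * (C k i j + C k j i)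

theorem ricCoeff_comm (C : κ → κ → κ → ℝ) (i j : κ) : ricCoeff C i j = ricCoeff C j i := by
  unfold ricCoeff
  rw [Finset.sum_comm (f := fun k l => C i k l * C j l k)]
  simp only [mul_comm (C _ i _), mul_comm (C _ _ i), mul_comm (C i _ _), add_comm (C _ i _)]

theorem inner_Ric (μ : E →ₗ[ℝ] E →ₗ[ℝ] E) (e : OrthonormalBasis κ ℝ E) (C : κ → κ → κ → ℝ)
    (hC : ∀ i j, μ (e i) (e j) = ∑ k, C i j k • e k) (i j : κ) :
    ⟪Ric μ (e i), e j⟫ = ricCoeff C i j := by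
  classical
  have hC' : ∀ i j k, ⟪μ (e i) (e j), e k⟫ = C i j k := fun i j k => by
    simp [hC, sum_inner, inner_smul_left, e.inner_eq_ite]
  have hC'' : ∀ i j k, ⟪e k, μ (e i) (e j)⟫ = C i j k := fun i j k => by
    rw [real_inner_comm, hC']
  have htr : ∀ k, LinearMap.trace ℝ E (μ (e k)) = ∑ l, C k l l := fun k => by
    rw [LinearMap.trace_eq_sum_inner _ e]
    simp [hC'']
  have hR : ⟪Rop μ (e i), e j⟫ =
      -(1 / 2) * ∑ k, ∑ l, C k i l * C k j l + 1 / 4 * ∑ k, ∑ l, C k l i * C k l j := by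
    have h1 : ∑ k, ⟪μ (stdONB E k) (e i), μ (stdONB E k) (e j)⟫ =
        ∑ k, ∑ l, C k i l * C k j l := by
      rw [sum_inner_bracket_left_eq μ _ e]
      refine Finset.sum_congr rfl fun k _ => ?_
      rw [← e.sum_inner_mul_inner]
      simp [hC', hC'']
    have h2 := sum_inner_transp_eq μ (stdONB E) e (e i) (e j)
    simp only [hC'] at h2
    rw [← h1, ← h2]
    simp [Rop, transp, inner_add_left, inner_smul_left, sum_inner, LinearMap.adjoint_inner_left,
      LinearMap.adjoint_inner_right]
  have hB : ⟪Bop μ (e i), e j⟫ = ∑ k, ∑ l, C i k l * C j l k := by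
    rw [inner_Bop, LinearMap.trace_eq_sum_inner _ e, Finset.sum_comm]
    refine Finset.sum_congr rfl fun k _ => ?_
    simp [hC j, inner_sum, inner_smul_right, hC'', mul_comm]
  have hS : ⟪symPart (μ (meanCurv μ)) (e i), e j⟫ =
      1 / 2 * ∑ k, (∑ l, C k l l) * (C k i j + C k j i) := by
    have h (i j : κ) : ⟪μ (meanCurv μ) (e i), e j⟫ = ∑ k, (∑ l, C k l l) * C k i j := by
      simp [meanCurv_eq μ e, sum_inner, inner_smul_left, hC', htr]
    simp only [mul_add, Finset.sum_add_distrib, ← h]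
    simp [symPart, transp, inner_add_left, inner_smul_left, LinearMap.adjoint_inner_left,
      real_inner_comm]
  rw [Ric, LinearMap.sub_apply, LinearMap.sub_apply, inner_sub_left, inner_sub_left, hR, hS,
    LinearMap.smul_apply, inner_smul_left, hB]
  simp [ricCoeff]

/-- The solsoliton equation in an orthonormal basis with structure constants `C`. -/
theorem IsSolsoliton.exists_coeff [DecidableEq κ] {μ : E →ₗ[ℝ] E →ₗ[ℝ] E} (hμ : IsSolsoliton μ)
    (e : OrthonormalBasis κ ℝ E) (C : κ → κ → κ → ℝ)
    (hC : ∀ i j, μ (e i) (e j) = ∑ k, C i j k • e k) :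
    ∃ (t : ℝ) (d : κ → κ → ℝ), (∀ i j, d i j = ricCoeff C i j - if i = j then t else 0) ∧
      ∀ i j l, ∑ k, C i j k * d k l = ∑ k, d i k * C k j l + ∑ k, d j k * C i k l := by
  obtain ⟨t, D, hD, hRic⟩ := hμ
  have hC' : ∀ i j k, ⟪μ (e i) (e j), e k⟫ = C i j k := fun i j k => by
    simp [hC, sum_inner, inner_smul_left, e.inner_eq_ite]
  have hDe : ∀ i, D (e i) = ∑ k, ⟪D (e i), e k⟫ • e k := fun i => by
    conv_lhs => rw [← e.sum_repr' (D (e i))]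
    simp [real_inner_comm]
  refine ⟨t, fun i j => ⟪D (e i), e j⟫, fun i j => ?_, fun i j l => ?_⟩
  · rw [← inner_Ric μ e C hC, hRic]
    simp [inner_add_left, inner_smul_left, e.inner_eq_ite]
  · have h := congrArg (fun v => ⟪v, e l⟫) (hD (e i) (e j))
    simp only [hC i j, inner_add_left] at h
    rw [hDe i, hDe j] at h
    simpa [sum_inner, inner_smul_left, hC'] using h

/-- Gram–Schmidt: relative to any basis there is an orthonormal basis with triangular
coordinates. -/
theorem exists_orthonormalBasis_triangular {n : ℕ} (v : Module.Basis (Fin n) ℝ E) :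
    ∃ e : OrthonormalBasis (Fin n) ℝ E,
      (∀ i j, i < j → v.repr (e i) j = 0) ∧ ∀ i, v.repr (e i) i ≠ 0 := by
  have hcard : Module.finrank ℝ E = Fintype.card (Fin n) := Module.finrank_eq_card_basis v
  let e := InnerProductSpace.gramSchmidtOrthonormalBasis hcard v
  have htri : ∀ i j, i < j → v.repr (e i) j = 0 := fun i j hij => by
    have hne : InnerProductSpace.gramSchmidtNormed ℝ v i ≠ 0 := fun h => by
      have := InnerProductSpace.gramSchmidtNormed_unit_length (𝕜 := ℝ) i v.linearIndependent
      simp [h] at this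
    simp [e, InnerProductSpace.gramSchmidtOrthonormalBasis_apply hcard hne,
      InnerProductSpace.gramSchmidtNormed, InnerProductSpace.gramSchmidt_triangular hij v]
  refine ⟨e, htri, fun i hi => ?_⟩
  have hdet : v.det e.toBasis = ∏ i, v.repr (e i) i := by
    rw [Module.Basis.det_apply, Matrix.det_of_isUpperTriangular]
    · simp [Module.Basis.toMatrix_apply]
    · intro i j hij
      simpa [Module.Basis.toMatrix_apply] using htri j i hij
  have h := v.isUnit_det e.toBasis
  rw [hdet, Finset.prod_eq_zero (f := fun i => v.repr (e i) i) (Finset.mem_univ i) hi] at h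
  exact not_isUnit_zero h

end OrthonormalFrames

section StructureConstants

/-- The structure constants of the algebra `[e₃,e₀] = p e₀`, `[e₃,e₁] = a e₀ + q e₁`,
`[e₃,e₂] = b e₀ + c e₁ + r e₂`, `[e₁,e₂] = h e₀`. -/
def structConst (p q r a b c h : ℝ) : Fin 4 → Fin 4 → Fin 4 → ℝ :=
  ![![0, 0, 0, ![-p, 0, 0, 0]],
    ![0, 0, ![h, 0, 0, 0], ![-a, -q, 0, 0]],
    ![0, ![-h, 0, 0, 0], 0, ![-b, -c, -r, 0]],
    ![![p, 0, 0, 0], ![a, q, 0, 0], ![b, c, r, 0], 0]]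

theorem offDiag_eq_zero_of_soliton_coeff {p q r a b c h t : ℝ} {d : Fin 4 → Fin 4 → ℝ}
    (hM : p ^ 2 + q ^ 2 + r ^ 2 ≠ 0) (hh : h = 0 ∨ q ≠ 0 ∧ r ≠ 0)
    (hd : ∀ i j, d i j = ricCoeff (structConst p q r a b c h) i j - if i = j then t else 0)
    (hD : ∀ i j l, ∑ k, structConst p q r a b c h i j k * d k l =
      ∑ k, d i k * structConst p q r a b c h k j l +
        ∑ k, d j k * structConst p q r a b c h i k l) :
    a = 0 ∧ c = 0 := by
  have e00 : d 0 0 = (a ^ 2 + b ^ 2) / 2 + h ^ 2 / 2 - (p + q + r) * p - t := by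
    rw [hd]; simp [ricCoeff, structConst, Fin.sum_univ_four]; ring
  have e01 : d 0 1 = (a * q + b * c - p * a) / 2 - (p + q + r) * a / 2 := by
    rw [hd]; simp [ricCoeff, structConst, Fin.sum_univ_four]; ring
  have e02 : d 0 2 = (b * r - p * b) / 2 - (p + q + r) * b / 2 := by
    rw [hd]; simp [ricCoeff, structConst, Fin.sum_univ_four]; ring
  have e11 : d 1 1 = (c ^ 2 - a ^ 2) / 2 - h ^ 2 / 2 - (p + q + r) * q - t := by
    rw [hd]; simp [ricCoeff, structConst, Fin.sum_univ_four]; ring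
  have e12 : d 1 2 = (c * r - a * b - q * c) / 2 - (p + q + r) * c / 2 := by
    rw [hd]; simp [ricCoeff, structConst, Fin.sum_univ_four]; ring
  have e22 : d 2 2 = (-b ^ 2 - c ^ 2) / 2 - h ^ 2 / 2 - (p + q + r) * r - t := by
    rw [hd]; simp [ricCoeff, structConst, Fin.sum_univ_four]; ring
  have e03 : d 0 3 = 0 := by
    rw [hd]; simp [ricCoeff, structConst, Fin.sum_univ_four]
  have e13 : d 1 3 = -(h * b) / 2 := by
    rw [hd]; simp [ricCoeff, structConst, Fin.sum_univ_four]; ring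
  have e23 : d 2 3 = h * a / 2 := by
    rw [hd]; simp [ricCoeff, structConst, Fin.sum_univ_four]; ring
  have hsymm : ∀ i j, d i j = d j i := fun i j => by
    rw [hd, hd, ricCoeff_comm, if_congr (eq_comm (a := i)) rfl rfl]
  have hab : h = 0 ∨ a = 0 ∧ b = 0 := by
    rcases hh with hh | ⟨hq, hr⟩
    · exact .inl hh
    by_cases h0 : h = 0
    · exact .inl h0
    have h1 := hD 3 1 3
    have h2 := hD 3 2 3
    simp [structConst, Fin.sum_univ_four, e03, e13, e23, hq, h0] at h1
    simp [structConst, Fin.sum_univ_four, e03, e13, e23, h1, hr, h0] at h2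
    exact .inr ⟨h2, h1⟩
  have n00 := hD 3 0 0
  have n01 := hD 3 0 1
  have n02 := hD 3 0 2
  have n10 := hD 3 1 0
  have n11 := hD 3 1 1
  have n12 := hD 3 1 2
  have n20 := hD 3 2 0
  have n21 := hD 3 2 1
  have n22 := hD 3 2 2
  have hha : h * a = 0 := by rcases hab with h | h <;> simp [h]
  have hhb : h * b = 0 := by rcases hab with h | h <;> simp [h]
  simp only [hsymm 3 0, hsymm 3 1, hsymm 3 2, hsymm 1 0, hsymm 2 0, hsymm 2 1, structConst,
    Fin.sum_univ_four, e03, e13, e23, hha, hhb, Matrix.cons_val, Pi.zero_apply, mul_zero,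
    zero_mul, add_zero, zero_add, neg_zero, zero_div] at n00 n01 n02 n10 n11 n12 n20 n21 n22
  have h33 : d 3 3 = 0 := by
    have : d 3 3 * (p ^ 2 + q ^ 2 + r ^ 2) = 0 := by
      linear_combination -p * n00 - q * n11 - r * n22 - a * n01 - b * n02 - c * n12
    simpa [hM] using this
  rw [h33] at n00 n10 n11 n20 n21 n22
  rw [e00, e01, e02, e11, e12, e22] at *
  have key : (a ^ 2 + b ^ 2) ^ 2 + (b ^ 2 + c ^ 2) ^ 2 = 0 := by
    have h1 : (a ^ 2 + b ^ 2) ^ 2 + (c ^ 2 - a ^ 2) ^ 2 + (b ^ 2 + c ^ 2) ^ 2 +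
        2 * (a * q + b * c - p * a) ^ 2 + 2 * (b * r - p * b) ^ 2 +
        2 * (c * r - a * b - q * c) ^ 2 = 0 := by
      linear_combination 2 * (p * n00 + a * n10 + q * n11 + b * n20 + c * n21 + r * n22)
        - 2 * h * a * hha - 2 * h * b * hhb
    refine le_antisymm (h1 ▸ ?_) (by positivity)
    linarith only [sq_nonneg (c ^ 2 - a ^ 2), sq_nonneg (a * q + b * c - p * a),
      sq_nonneg (b * r - p * b), sq_nonneg (c * r - a * b - q * c)]
  obtain ⟨h1, h2⟩ := (add_eq_zero_iff_of_nonneg (by positivity) (by positivity)).1 key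
  rw [sq_eq_zero_iff, add_eq_zero_iff_of_nonneg (by positivity) (by positivity)] at h1 h2
  exact ⟨sq_eq_zero_iff.1 h1.1, sq_eq_zero_iff.1 h2.2⟩

end StructureConstants

section Realizations

variable {E : Type*} [NormedAddCommGroup E] [InnerProductSpace ℝ E] [FiniteDimensional ℝ E]

/-- A metric Lie algebra with the brackets of `structConst` in an orthonormal frame, where
`ad e₃` is not nilpotent and not diagonal, is not a solsoliton. -/
theorem not_isSolsoliton_of_frame {μ : E →ₗ[ℝ] E →ₗ[ℝ] E} (e : OrthonormalBasis (Fin 4) ℝ E)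
    {p q r a b c h : ℝ} (hself : ∀ X, μ X X = 0) (h01 : μ (e 0) (e 1) = 0)
    (h02 : μ (e 0) (e 2) = 0) (h12 : μ (e 1) (e 2) = h • e 0) (h30 : μ (e 3) (e 0) = p • e 0)
    (h31 : μ (e 3) (e 1) = a • e 0 + q • e 1)
    (h32 : μ (e 3) (e 2) = b • e 0 + c • e 1 + r • e 2)
    (hM : p ^ 2 + q ^ 2 + r ^ 2 ≠ 0) (hh : h = 0 ∨ q ≠ 0 ∧ r ≠ 0) (hac : a ≠ 0 ∨ c ≠ 0) :
    ¬ IsSolsoliton μ := by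
  intro hμ
  have hanti : ∀ X Y, μ X Y = -μ Y X := fun X Y => by
    have h := hself (X + Y)
    simp only [map_add, LinearMap.add_apply, hself, zero_add, add_zero] at h
    exact eq_neg_of_add_eq_zero_right h
  have hC : ∀ i j, μ (e i) (e j) = ∑ k, structConst p q r a b c h i j k • e k := by
    intro i j
    fin_cases i <;> fin_cases j <;>
      simp [structConst, Fin.sum_univ_four, hself, h01, h02, h12, h30, h31, h32,
        hanti (e 1) (e 0), hanti (e 2) (e 0), hanti (e 2) (e 1), hanti (e 0) (e 3),
        hanti (e 1) (e 3), hanti (e 2) (e 3)] <;> abel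
  obtain ⟨t, d, hd, hD⟩ := hμ.exists_coeff e _ hC
  obtain ⟨ha, hc⟩ := offDiag_eq_zero_of_soliton_coeff hM hh hd hD
  exact hac.elim (· ha) (· hc)

/-- For a linear isomorphism with `Fin n → ℝ` and an ordering `σ` of the coordinates there is an
orthonormal basis with triangular coordinates. -/
theorem exists_orthonormalBasis_triangular_equiv {n : ℕ} (g : E ≃ₗ[ℝ] (Fin n → ℝ))
    (σ : Equiv.Perm (Fin n)) :
    ∃ e : OrthonormalBasis (Fin n) ℝ E,
      (∀ i j, i < j → g (e i) (σ j) = 0) ∧ ∀ i, g (e i) (σ i) ≠ 0 := by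
  simpa using exists_orthonormalBasis_triangular ((Module.Basis.ofEquivFun g).reindex σ.symm)

theorem not_isSolsoliton_r4 {μ : E →ₗ[ℝ] E →ₗ[ℝ] E} (g : E ≃ₗ[ℝ] (Fin 4 → ℝ))
    (hg : ∀ X Y, g (μ X Y) = r4Bracket (g X) (g Y)) : ¬ IsSolsoliton μ := by
  obtain ⟨e, htri, hdiag⟩ := exists_orthonormalBasis_triangular_equiv g (finRotate 4)
  have f0 : g (e 0) = ![0, g (e 0) 1, 0, 0] := by
    ext i; fin_cases i
    exacts [htri 0 3 (by decide), rfl, htri 0 1 (by decide), htri 0 2 (by decide)]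
  have f1 : g (e 1) = ![0, g (e 1) 1, g (e 1) 2, 0] := by
    ext i; fin_cases i
    exacts [htri 1 3 (by decide), rfl, rfl, htri 1 2 (by decide)]
  have f2 : g (e 2) = ![0, g (e 2) 1, g (e 2) 2, g (e 2) 3] := by
    ext i; fin_cases i
    exacts [htri 2 3 (by decide), rfl, rfl, rfl]
  have f3 : g (e 3) = ![g (e 3) 0, g (e 3) 1, g (e 3) 2, g (e 3) 3] := by
    ext i; fin_cases i <;> rfl
  have hα : g (e 0) 1 ≠ 0 := hdiag 0
  have hβ : g (e 1) 2 ≠ 0 := hdiag 1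
  have hδ : g (e 3) 0 ≠ 0 := hdiag 3
  generalize g (e 0) 1 = α at *
  generalize g (e 1) 1 = β₁ at *
  generalize g (e 1) 2 = β at *
  generalize g (e 2) 1 = γ₁ at *
  generalize g (e 2) 2 = γ₂ at *
  generalize g (e 2) 3 = γ at *
  generalize g (e 3) 0 = δ at *
  generalize g (e 3) 1 = δ₁ at *
  generalize g (e 3) 2 = δ₂ at *
  generalize g (e 3) 3 = δ₃ at *
  refine not_isSolsoliton_of_frame e (p := δ) (q := δ) (r := δ) (a := δ * β / α)
    (b := δ * (γ₂ - γ * β₁ / β) / α) (c := δ * γ / β) (h := 0) (fun X => g.injective ?_)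
    (g.injective ?_) (g.injective ?_) (g.injective ?_) (g.injective ?_) (g.injective ?_)
    (g.injective ?_) (by positivity) (.inl rfl) (.inl (by positivity))
  all_goals
    simp only [hg, map_add, map_smul, map_zero, f0, f1, f2, f3]
    ext i
    fin_cases i <;> simp [r4Bracket] <;> field_simp <;> ring

theorem not_isSolsoliton_r4lam {μ : E →ₗ[ℝ] E →ₗ[ℝ] E} (lam : ℝ) (g : E ≃ₗ[ℝ] (Fin 4 → ℝ))
    (hg : ∀ X Y, g (μ X Y) = r4lamBracket lam (g X) (g Y)) : ¬ IsSolsoliton μ := by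
  obtain ⟨e, htri, hdiag⟩ :=
    exists_orthonormalBasis_triangular_equiv g ⟨![2, 3, 1, 0], ![3, 2, 0, 1], by decide, by decide⟩
  have f0 : g (e 0) = ![0, 0, g (e 0) 2, 0] := by
    ext i; fin_cases i
    exacts [htri 0 3 (by decide), htri 0 2 (by decide), rfl, htri 0 1 (by decide)]
  have f1 : g (e 1) = ![0, 0, g (e 1) 2, g (e 1) 3] := by
    ext i; fin_cases i
    exacts [htri 1 3 (by decide), htri 1 2 (by decide), rfl, rfl]
  have f2 : g (e 2) = ![0, g (e 2) 1, g (e 2) 2, g (e 2) 3] := by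
    ext i; fin_cases i
    exacts [htri 2 3 (by decide), rfl, rfl, rfl]
  have f3 : g (e 3) = ![g (e 3) 0, g (e 3) 1, g (e 3) 2, g (e 3) 3] := by
    ext i; fin_cases i <;> rfl
  have hα : g (e 0) 2 ≠ 0 := hdiag 0
  have hβ : g (e 1) 3 ≠ 0 := hdiag 1
  have hδ : g (e 3) 0 ≠ 0 := hdiag 3
  generalize g (e 0) 2 = α at *
  generalize g (e 1) 2 = β₂ at *
  generalize g (e 1) 3 = β at *
  generalize g (e 2) 1 = γ at *
  generalize g (e 2) 2 = γ₂ at *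
  generalize g (e 2) 3 = γ₃ at *
  generalize g (e 3) 0 = δ at *
  generalize g (e 3) 1 = δ₁ at *
  generalize g (e 3) 2 = δ₂ at *
  generalize g (e 3) 3 = δ₃ at *
  refine not_isSolsoliton_of_frame e (p := lam * δ) (q := lam * δ) (r := δ) (a := δ * β / α)
    (b := δ * (lam * γ₂ + γ₃ - γ₂ - (lam - 1) * γ₃ * β₂ / β) / α)
    (c := (lam - 1) * δ * γ₃ / β) (h := 0) (fun X => g.injective ?_)
    (g.injective ?_) (g.injective ?_) (g.injective ?_) (g.injective ?_) (g.injective ?_)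
    (g.injective ?_) (by positivity) (.inl rfl) (.inl (by positivity))
  all_goals
    simp only [hg, map_add, map_smul, map_zero, f0, f1, f2, f3]
    ext i
    fin_cases i <;> simp [r4lamBracket] <;> field_simp <;> ring

theorem not_isSolsoliton_h4 {μ : E →ₗ[ℝ] E →ₗ[ℝ] E} (g : E ≃ₗ[ℝ] (Fin 4 → ℝ))
    (hg : ∀ X Y, g (μ X Y) = h4Bracket (g X) (g Y)) : ¬ IsSolsoliton μ := by
  obtain ⟨e, htri, hdiag⟩ :=
    exists_orthonormalBasis_triangular_equiv g ⟨![3, 1, 2, 0], ![3, 1, 2, 0], by decide, by decide⟩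
  have f0 : g (e 0) = ![0, 0, 0, g (e 0) 3] := by
    ext i; fin_cases i
    exacts [htri 0 3 (by decide), htri 0 1 (by decide), htri 0 2 (by decide), rfl]
  have f1 : g (e 1) = ![0, g (e 1) 1, 0, g (e 1) 3] := by
    ext i; fin_cases i
    exacts [htri 1 3 (by decide), rfl, htri 1 2 (by decide), rfl]
  have f2 : g (e 2) = ![0, g (e 2) 1, g (e 2) 2, g (e 2) 3] := by
    ext i; fin_cases i
    exacts [htri 2 3 (by decide), rfl, rfl, rfl]
  have f3 : g (e 3) = ![g (e 3) 0, g (e 3) 1, g (e 3) 2, g (e 3) 3] := by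
    ext i; fin_cases i <;> rfl
  have hα : g (e 0) 3 ≠ 0 := hdiag 0
  have hβ : g (e 1) 1 ≠ 0 := hdiag 1
  have hγ : g (e 2) 2 ≠ 0 := hdiag 2
  have hδ : g (e 3) 0 ≠ 0 := hdiag 3
  generalize g (e 0) 3 = α at *
  generalize g (e 1) 1 = β at *
  generalize g (e 1) 3 = β₃ at *
  generalize g (e 2) 1 = γ₁ at *
  generalize g (e 2) 2 = γ at *
  generalize g (e 2) 3 = γ₃ at *
  generalize g (e 3) 0 = δ at *
  generalize g (e 3) 1 = δ₁ at *
  generalize g (e 3) 2 = δ₂ at *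
  generalize g (e 3) 3 = δ₃ at *
  refine not_isSolsoliton_of_frame e (p := 2 * δ) (q := δ) (r := δ)
    (a := (δ * β₃ - δ₂ * β) / α)
    (b := (δ * γ₃ + δ₁ * γ - δ₂ * γ₁ - δ * γ * β₃ / β) / α)
    (c := δ * γ / β) (h := β * γ / α) (fun X => g.injective ?_)
    (g.injective ?_) (g.injective ?_) (g.injective ?_) (g.injective ?_) (g.injective ?_)
    (g.injective ?_) (by positivity) (.inr ⟨hδ, hδ⟩) (.inr (by positivity))
  all_goals
    simp only [hg, map_add, map_smul, map_zero, f0, f1, f2, f3]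
    ext i
    fin_cases i <;> simp [h4Bracket] <;> field_simp <;> ring

end Realizations

/-- none of the `4`-dimensional solvable Lie algebras `r₄`, `r_{4,lam}`
(for any `lam ∈ ℝ`) and `h₄` admits a solsoliton inner product: any metric realization of any
of them fails to be a solsoliton. -/
theorem four_dim_no_solsoliton :
    (∀ (E : Type) (_i₁ : NormedAddCommGroup E) (_i₂ : InnerProductSpace ℝ E)
        (_i₃ : FiniteDimensional ℝ E) (μ : E →ₗ[ℝ] E →ₗ[ℝ] E),
        (∃ g : E ≃ₗ[ℝ] (Fin 4 → ℝ), ∀ X Y, g (μ X Y) = r4Bracket (g X) (g Y)) →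
          ¬ IsSolsoliton μ) ∧
      (∀ (lam : ℝ) (E : Type) (_i₁ : NormedAddCommGroup E) (_i₂ : InnerProductSpace ℝ E)
        (_i₃ : FiniteDimensional ℝ E) (μ : E →ₗ[ℝ] E →ₗ[ℝ] E),
        (∃ g : E ≃ₗ[ℝ] (Fin 4 → ℝ), ∀ X Y, g (μ X Y) = r4lamBracket lam (g X) (g Y)) →
          ¬ IsSolsoliton μ) ∧
      ∀ (E : Type) (_i₁ : NormedAddCommGroup E) (_i₂ : InnerProductSpace ℝ E)
        (_i₃ : FiniteDimensional ℝ E) (μ : E →ₗ[ℝ] E →ₗ[ℝ] E),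
        (∃ g : E ≃ₗ[ℝ] (Fin 4 → ℝ), ∀ X Y, g (μ X Y) = h4Bracket (g X) (g Y)) →
          ¬ IsSolsoliton μ := by
  exact ⟨fun E _ _ _ μ ⟨g, hg⟩ => not_isSolsoliton_r4 g hg,
    fun lam E _ _ _ μ ⟨g, hg⟩ => not_isSolsoliton_r4lam lam g hg,
    fun E _ _ _ μ ⟨g, hg⟩ => not_isSolsoliton_h4 g hg⟩
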